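/- arXiv:2010.02040 — 5 statements merged into one kernel-verified Lean document; each statement's English description precedes it below -/
import Mathlib

section
/- Let 0 < γ ≤ α ≤ β be real numbers, let a < b, and let y : [a,b] → ℝ be continuous. Then for every t ∈ [a,b], |J^α_a y(t) − J^β_a y(t)| ≤ [ (Γ(γ)/Γ(α)) (b−a)^{α−γ} + (Γ(γ)/Γ(β)) (b−a)^{β−γ} ] · J^γ_a |y|(t), where |y| denotes the function τ ↦ |y(τ)|. -/
/-- Riemann–Liouville fractional integral of order `α` with base point `a`:
`J^α_a y (t) = (1/Γ(α)) ∫_a^t (t-τ)^(α-1) y(τ) dτ`. -/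
noncomputable def rlInt (a α : ℝ) (y : ℝ → ℝ) (t : ℝ) : ℝ :=
  (1 / Real.Gamma α) * ∫ τ in a..t, (t - τ) ^ (α - 1) * y τ

theorem intervalIntegrable_sub_rpow_mul {a t r : ℝ} {g : ℝ → ℝ} (hr : -1 < r) (hat : a ≤ t)
    (hg : ContinuousOn g (Set.Icc a t)) :
    IntervalIntegrable (fun τ => (t - τ) ^ r * g τ) MeasureTheory.volume a t := by
  have h := (intervalIntegral.intervalIntegrable_rpow' (a := t - a) (b := 0) hr).comp_sub_left t
  simp only [sub_sub_cancel, sub_zero] at h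
  exact h.mul_continuousOn (by rwa [Set.uIcc_of_le hat])

theorem abs_rlInt_le {a b α γ t : ℝ} {y : ℝ → ℝ} (hγ : 0 < γ) (hγα : γ ≤ α)
    (ht : t ∈ Set.Icc a b) (hy : ContinuousOn y (Set.Icc a b)) :
    |rlInt a α y t| ≤
      Real.Gamma γ / Real.Gamma α * (b - a) ^ (α - γ) * rlInt a γ (fun τ => |y τ|) t := by
  have hα : 0 < Real.Gamma α := Real.Gamma_pos_of_pos (hγ.trans_le hγα)
  have hΓ : 0 < Real.Gamma γ := Real.Gamma_pos_of_pos hγ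
  have hint : IntervalIntegrable (fun τ => (t - τ) ^ (γ - 1) * |y τ|) MeasureTheory.volume a t :=
    intervalIntegrable_sub_rpow_mul (by linarith) ht.1
      (hy.mono (Set.Icc_subset_Icc_right ht.2)).abs
  have hne : ∀ᵐ τ ∂(MeasureTheory.volume : MeasureTheory.Measure ℝ), τ ≠ t :=
    MeasureTheory.Measure.ae_ne _ t
  have key : |∫ τ in a..t, (t - τ) ^ (α - 1) * y τ| ≤
      ∫ τ in a..t, (b - a) ^ (α - γ) * ((t - τ) ^ (γ - 1) * |y τ|) := by
    rw [← Real.norm_eq_abs]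
    refine intervalIntegral.norm_integral_le_of_norm_le ht.1 ?_ (hint.const_mul _)
    filter_upwards [hne] with τ hτt hτ
    have hpos : 0 < t - τ := sub_pos.2 (lt_of_le_of_ne hτ.2 hτt)
    rw [norm_mul, Real.norm_eq_abs, Real.norm_eq_abs, abs_of_pos (Real.rpow_pos_of_pos hpos _),
      ← mul_assoc, show α - 1 = (α - γ) + (γ - 1) by ring, Real.rpow_add hpos]
    gcongr
    · exact ht.2
    · exact hτ.1.le
  rw [intervalIntegral.integral_const_mul] at key
  unfold rlInt
  rw [abs_mul, abs_of_pos (one_div_pos.2 hα)]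
  refine (mul_le_mul_of_nonneg_left key (one_div_pos.2 hα).le).trans_eq ?_
  field_simp


theorem stmt0 (a b α β γ : ℝ) (y : ℝ → ℝ)
    (hab : a < b) (hγ : 0 < γ) (hγα : γ ≤ α) (hαβ : α ≤ β)
    (hy : ContinuousOn y (Set.Icc a b)) :
    ∀ t ∈ Set.Icc a b,
      |rlInt a α y t - rlInt a β y t| ≤
        (Real.Gamma γ / Real.Gamma α * (b - a) ^ (α - γ) +
          Real.Gamma γ / Real.Gamma β * (b - a) ^ (β - γ)) *
          rlInt a γ (fun τ => |y τ|) t := by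
  intro t ht
  refine (abs_sub _ _).trans ?_
  rw [add_mul]
  exact add_le_add (abs_rlInt_le hγ hγα ht hy) (abs_rlInt_le hγ (hγα.trans hαβ) ht hy)
end

section
/- Let f be continuous on [a,b] with a < b, let α > 0, and let (α_k) be a sequence of positive real numbers with α_k → α as k → ∞. Then for every δ > 0 with a + δ ≤ b, lim_{k→∞} sup_{t ∈ [a+δ, b]} |J^{α_k}_a f(t) − J^{α}_a f(t)| = 0. -/
/-- The convolution kernel of the Riemann–Liouville integral of order `α`. -/
noncomputable def rlKernel (α s : ℝ) : ℝ := 1 / Real.Gamma α * s ^ (α - 1)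

lemma rlKernel_intervalIntegrable {α : ℝ} (hα : 0 < α) (c d : ℝ) :
    IntervalIntegrable (rlKernel α) MeasureTheory.volume c d :=
  (intervalIntegral.intervalIntegrable_rpow' (by linarith)).const_mul _

lemma rpow_sub_one_le_add {s p q β : ℝ} (hs : 0 < s) (hp : p ≤ β) (hq : β ≤ q) :
    s ^ (β - 1) ≤ s ^ (p - 1) + s ^ (q - 1) := by
  have hp' := Real.rpow_pos_of_pos hs (p - 1)
  have hq' := Real.rpow_pos_of_pos hs (q - 1)
  rcases le_total s 1 with h | h
  · have := Real.rpow_le_rpow_of_exponent_ge hs h (by linarith : p - 1 ≤ β - 1)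
    linarith
  · have := Real.rpow_le_rpow_of_exponent_le h (by linarith : β - 1 ≤ q - 1)
    linarith

/-- The kernels depend continuously on the order in `L¹(0, c)`. -/
lemma tendsto_integral_abs_rlKernel_sub {α : ℝ} (hα : 0 < α) {c : ℝ} (hc : 0 ≤ c) :
    Filter.Tendsto (fun β => ∫ s in (0 : ℝ)..c, |rlKernel β s - rlKernel α s|)
      (nhds α) (nhds 0) := by
  have hΓ : ContinuousAt (fun β => 1 / Real.Gamma β) α := by
    refine continuousAt_const.div
      (Real.differentiableAt_Gamma fun m => ?_).continuousAt (Real.Gamma_pos_of_pos hα).ne'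
    have : (0 : ℝ) ≤ m := m.cast_nonneg
    linarith
  set C := |1 / Real.Gamma α| + 1 with hC
  have hbound : ∀ β s, 0 < s → |1 / Real.Gamma β| ≤ C → α / 2 ≤ β → β ≤ 2 * α →
      |rlKernel β s| ≤ C * (s ^ (α / 2 - 1) + s ^ (2 * α - 1)) := by
    intro β s hs hβ h1 h2
    rw [rlKernel, abs_mul, abs_of_pos (Real.rpow_pos_of_pos hs (β - 1))]
    have := Real.rpow_pos_of_pos hs (β - 1)
    gcongr
    exact rpow_sub_one_le_add hs h1 h2
  have hΓC : ∀ᶠ β in nhds α, |1 / Real.Gamma β| ≤ C :=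
    (hΓ.abs.eventually_lt continuousAt_const (lt_add_one _)).mono fun _ h => h.le
  suffices h : Filter.Tendsto (fun β => ∫ s in (0 : ℝ)..c, |rlKernel β s - rlKernel α s|)
      (nhds α) (nhds (∫ _ in (0 : ℝ)..c, (0 : ℝ))) by
    rwa [intervalIntegral.integral_zero] at h
  refine intervalIntegral.tendsto_integral_filter_of_dominated_convergence
    (fun s => 2 * (C * (s ^ (α / 2 - 1) + s ^ (2 * α - 1)))) ?_ ?_ ?_ ?_
  · filter_upwards [lt_mem_nhds hα] with β hβ
    exact (intervalIntegrable_iff.1 ((rlKernel_intervalIntegrable hβ 0 c).sub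
      (rlKernel_intervalIntegrable hα 0 c)).abs).aestronglyMeasurable
  · filter_upwards [hΓC, le_mem_nhds (show α / 2 < α by linarith),
      ge_mem_nhds (show α < 2 * α by linarith)] with β h1 h2 h3
    refine Filter.Eventually.of_forall fun s hs => ?_
    rw [Set.uIoc_of_le hc] at hs
    rw [Real.norm_eq_abs, abs_abs]
    have e1 := hbound β s hs.1 h1 h2 h3
    have e2 := hbound α s hs.1 (by linarith) (by linarith) (by linarith)
    have e3 := abs_sub (rlKernel β s) (rlKernel α s)
    linarith
  · exact (((intervalIntegral.intervalIntegrable_rpow' (by linarith)).add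
      (intervalIntegral.intervalIntegrable_rpow' (by linarith))).const_mul _).const_mul _
  · refine Filter.Eventually.of_forall fun s hs => ?_
    rw [Set.uIoc_of_le hc] at hs
    have hk : ContinuousAt (fun β => rlKernel β s) α :=
      hΓ.mul (continuousAt_const.rpow (by fun_prop) (Or.inl hs.1.ne'))
    simpa using (hk.sub (continuousAt_const (y := rlKernel α s))).abs.tendsto

lemma rlInt_eq_integral_rlKernel (a α : ℝ) (y : ℝ → ℝ) (t : ℝ) :
    rlInt a α y t = ∫ τ in a..t, rlKernel α (t - τ) * y τ := by
  simp only [rlInt, rlKernel, mul_assoc, intervalIntegral.integral_const_mul]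

lemma abs_rlInt_sub_le {a b α β M t : ℝ} {f : ℝ → ℝ} (hf : ContinuousOn f (Set.Icc a b))
    (hM : ∀ x ∈ Set.Icc a b, |f x| ≤ M) (hα : 0 < α) (hβ : 0 < β) (ht : t ∈ Set.Icc a b) :
    |rlInt a β f t - rlInt a α f t| ≤
      (∫ s in (0 : ℝ)..(b - a), |rlKernel β s - rlKernel α s|) * M := by
  have hM0 : 0 ≤ M := (abs_nonneg _).trans (hM t ht)
  have hft : ContinuousOn f (Set.uIcc a t) := by
    rw [Set.uIcc_of_le ht.1]
    exact hf.mono (Set.Icc_subset_Icc_right ht.2)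
  have hcomp : ∀ {γ : ℝ}, 0 < γ →
      IntervalIntegrable (fun τ => rlKernel γ (t - τ)) MeasureTheory.volume a t := by
    intro γ hγ
    simpa using (rlKernel_intervalIntegrable hγ (t - a) (t - t)).comp_sub_left t
  have hdiff := ((rlKernel_intervalIntegrable hβ 0 (b - a)).sub
    (rlKernel_intervalIntegrable hα 0 (b - a))).abs
  rw [rlInt_eq_integral_rlKernel, rlInt_eq_integral_rlKernel, ← intervalIntegral.integral_sub
    ((hcomp hβ).mul_continuousOn hft) ((hcomp hα).mul_continuousOn hft), ← Real.norm_eq_abs]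
  calc _ ≤ ∫ τ in a..t, |rlKernel β (t - τ) - rlKernel α (t - τ)| * M := by
        refine intervalIntegral.norm_integral_le_of_norm_le ht.1
          (Filter.Eventually.of_forall fun τ hτ => ?_)
          (((hcomp hβ).sub (hcomp hα)).abs.mul_const M)
        rw [← sub_mul, Real.norm_eq_abs, abs_mul]
        exact mul_le_mul_of_nonneg_left (hM τ ⟨hτ.1.le, hτ.2.trans ht.2⟩) (abs_nonneg _)
    _ = (∫ s in (0 : ℝ)..(t - a), |rlKernel β s - rlKernel α s|) * M := by
        rw [intervalIntegral.integral_mul_const,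
          intervalIntegral.integral_comp_sub_left (fun s => |rlKernel β s - rlKernel α s|),
          sub_self]
    _ ≤ _ := by
        refine mul_le_mul_of_nonneg_right ?_ hM0
        exact intervalIntegral.integral_mono_interval le_rfl (by linarith [ht.1])
          (by linarith [ht.2]) (Filter.Eventually.of_forall fun _ => abs_nonneg _) hdiff

theorem stmt1 (a b α : ℝ) (f : ℝ → ℝ) (αk : ℕ → ℝ)
    (hab : a < b) (hf : ContinuousOn f (Set.Icc a b)) (hα : 0 < α)
    (hαk : ∀ k, 0 < αk k) (hlim : Filter.Tendsto αk Filter.atTop (nhds α)) :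
    ∀ δ > 0, a + δ ≤ b →
      Filter.Tendsto
        (fun k => ⨆ t : Set.Icc (a + δ) b, |rlInt a (αk k) f t - rlInt a α f t|)
        Filter.atTop (nhds 0) := by
  intro δ hδ hδb
  obtain ⟨M, hM⟩ := isCompact_Icc.exists_bound_of_continuousOn hf
  have hlimit := ((tendsto_integral_abs_rlKernel_sub hα (sub_nonneg.2 hab.le)).comp
    hlim).mul_const M
  rw [zero_mul] at hlimit
  have : Nonempty (Set.Icc (a + δ) b) := ⟨⟨b, hδb, le_rfl⟩⟩
  refine squeeze_zero (fun k => Real.iSup_nonneg fun _ => abs_nonneg _)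
    (fun k => ciSup_le fun t => ?_) hlimit
  exact abs_rlInt_sub_le hf hM hα (hαk k) ⟨by linarith [t.2.1], t.2.2⟩
end

section
/- Let f be continuous on [a,b] with a < b, and let (α_k) be a sequence of positive real numbers with α_k → 0 as k → ∞. Then for every δ > 0 with a + δ ≤ b, lim_{k→∞} sup_{t ∈ [a+δ, b]} |J^{α_k}_a f(t) − f(t)| = 0; that is, the Riemann–Liouville integrals J^{α_k}_a f converge uniformly to f on [a+δ, b] as the order tends to 0. -/
theorem intervalIntegrable_sub_rpow (a t : ℝ) {α : ℝ} (hα : 0 < α) :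
    IntervalIntegrable (fun τ => (t - τ) ^ (α - 1)) MeasureTheory.volume a t := by
  have h := (intervalIntegral.intervalIntegrable_rpow' (a := t - a) (b := 0) (r := α - 1)
    (by linarith)).comp_sub_left t
  simpa using h

theorem integral_sub_rpow (a t : ℝ) {α : ℝ} (hα : 0 < α) :
    ∫ τ in a..t, (t - τ) ^ (α - 1) = (t - a) ^ α / α := by
  rw [intervalIntegral.integral_comp_sub_left (fun x : ℝ => x ^ (α - 1)) t,
    integral_rpow (Or.inl (by linarith))]
  simp [Real.zero_rpow hα.ne']

theorem abs_rlInt_sub_le_s2 {a t α ε K : ℝ} {f : ℝ → ℝ} (hat : a ≤ t) (hα : 0 < α)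
    (hf : ContinuousOn f (Set.Icc a t))
    (h : ∀ τ ∈ Set.Icc a t, (t - τ) ^ (α - 1) * |f τ - f t| ≤ ε * (t - τ) ^ (α - 1) + K) :
    |rlInt a α f t - f t * ((t - a) ^ α / Real.Gamma (α + 1))|
      ≤ ε * ((t - a) ^ α / Real.Gamma (α + 1)) + K * (t - a) * (α / Real.Gamma (α + 1)) := by
  have hG := Real.Gamma_pos_of_pos hα
  have hker := intervalIntegrable_sub_rpow a t hα
  have hprod : IntervalIntegrable (fun τ => (t - τ) ^ (α - 1) * f τ) MeasureTheory.volume a t :=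
    hker.mul_continuousOn (by rwa [Set.uIcc_of_le hat])
  have hdiff : rlInt a α f t - f t * ((t - a) ^ α / Real.Gamma (α + 1))
      = (1 / Real.Gamma α) * ∫ τ in a..t, (t - τ) ^ (α - 1) * (f τ - f t) := by
    simp only [mul_sub]
    rw [intervalIntegral.integral_sub hprod (hker.mul_const _),
      intervalIntegral.integral_mul_const, integral_sub_rpow a t hα, rlInt,
      Real.Gamma_add_one hα.ne']
    field_simp
  have hbound : |∫ τ in a..t, (t - τ) ^ (α - 1) * (f τ - f t)|
      ≤ ε * ((t - a) ^ α / α) + K * (t - a) := by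
    calc |∫ τ in a..t, (t - τ) ^ (α - 1) * (f τ - f t)|
        ≤ ∫ τ in a..t, (ε * (t - τ) ^ (α - 1) + K) := by
          rw [← Real.norm_eq_abs]
          refine intervalIntegral.norm_integral_le_of_norm_le hat
            (Filter.Eventually.of_forall fun τ hτ => ?_)
            ((hker.const_mul ε).add intervalIntegrable_const)
          rw [norm_mul, Real.norm_eq_abs, Real.norm_eq_abs,
            abs_of_nonneg (Real.rpow_nonneg (sub_nonneg.2 hτ.2) _)]
          exact h τ (Set.Ioc_subset_Icc_self hτ)
      _ = ε * ((t - a) ^ α / α) + K * (t - a) := by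
          rw [intervalIntegral.integral_add (hker.const_mul ε) intervalIntegrable_const,
            intervalIntegral.integral_const_mul, integral_sub_rpow a t hα,
            intervalIntegral.integral_const, smul_eq_mul]
          ring
  rw [hdiff, abs_mul, abs_of_pos (by positivity : 0 < 1 / Real.Gamma α)]
  refine (mul_le_mul_of_nonneg_left hbound (by positivity)).trans_eq ?_
  rw [Real.Gamma_add_one hα.ne']
  field_simp

theorem tendsto_rpow_div_Gamma_add_one {c : ℝ} (hc : 0 < c) :
    Filter.Tendsto (fun α : ℝ => c ^ α / Real.Gamma (α + 1)) (nhds 0) (nhds 1) := by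
  have hΓ : ContinuousAt (fun α : ℝ => Real.Gamma (α + 1)) 0 := by
    refine ContinuousAt.comp (g := Real.Gamma) ?_ (by fun_prop)
    exact (Real.differentiableAt_Gamma fun m => by linarith [m.cast_nonneg (α := ℝ)]).continuousAt
  have h : ContinuousAt (fun α : ℝ => c ^ α / Real.Gamma (α + 1)) 0 :=
    (Real.continuousAt_const_rpow hc.ne').div hΓ (by simp)
  simpa [ContinuousAt] using h

theorem tendsto_div_Gamma_add_one :
    Filter.Tendsto (fun α : ℝ => α / Real.Gamma (α + 1)) (nhds 0) (nhds 0) := by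
  simpa [div_eq_mul_inv] using
    (Filter.tendsto_id (x := nhds (0 : ℝ))).mul (tendsto_rpow_div_Gamma_add_one one_pos)

theorem abs_sub_le_abs_add_abs {x y z c : ℝ} (hxy : x ≤ y) (hyz : y ≤ z) :
    |y - c| ≤ |x - c| + |z - c| := by
  rw [abs_le]
  constructor
  · linarith [neg_abs_le (x - c), abs_nonneg (z - c)]
  · linarith [le_abs_self (z - c), abs_nonneg (x - c)]

theorem rpow_mul_abs_sub_le {s η α ε M x y : ℝ} (hs : 0 ≤ s) (hη : 0 < η) (hη1 : η ≤ 1)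
    (hα : 0 < α) (hα1 : α ≤ 1) (hε : 0 ≤ ε) (hx : |x| ≤ M) (hy : |y| ≤ M)
    (h : s < η → |x - y| ≤ ε) :
    s ^ (α - 1) * |x - y| ≤ ε * s ^ (α - 1) + η⁻¹ * (2 * M) := by
  have hM : 0 ≤ M := (abs_nonneg x).trans hx
  have hp : 0 ≤ s ^ (α - 1) := Real.rpow_nonneg hs _
  rcases lt_or_ge s η with hsη | hsη
  · have := mul_le_mul_of_nonneg_left (h hsη) hp
    have : 0 ≤ η⁻¹ * (2 * M) := by positivity
    linarith
  · have hpow : s ^ (α - 1) ≤ η⁻¹ :=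
      calc s ^ (α - 1) ≤ η ^ (α - 1) :=
            Real.rpow_le_rpow_of_nonpos hη hsη (by linarith)
        _ ≤ η ^ (-1 : ℝ) := Real.rpow_le_rpow_of_exponent_ge hη hη1 (by linarith)
        _ = η⁻¹ := Real.rpow_neg_one η
    have hxy : |x - y| ≤ 2 * M := (abs_sub x y).trans (by linarith)
    have := mul_le_mul hpow hxy (abs_nonneg _) (by positivity)
    have : 0 ≤ ε * s ^ (α - 1) := by positivity
    linarith

theorem stmt2 (a b : ℝ) (f : ℝ → ℝ) (αk : ℕ → ℝ)
    (hab : a < b) (hf : ContinuousOn f (Set.Icc a b))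
    (hαk : ∀ k, 0 < αk k) (hlim : Filter.Tendsto αk Filter.atTop (nhds 0)) :
    ∀ δ > 0, a + δ ≤ b →
      Filter.Tendsto
        (fun k => ⨆ t : Set.Icc (a + δ) b, |rlInt a (αk k) f t - f t|)
        Filter.atTop (nhds 0) := by
  intro δ hδ hδb
  obtain ⟨M, hM⟩ := isCompact_Icc.exists_bound_of_continuousOn hf
  have hM0 : 0 ≤ M := (norm_nonneg _).trans (hM a ⟨le_rfl, hab.le⟩)
  have huc := Metric.uniformContinuousOn_iff.1
    (isCompact_Icc.uniformContinuousOn_of_continuous hf)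
  rw [Metric.tendsto_nhds]
  intro e he
  obtain ⟨η₀, hη₀, hclose⟩ := huc (e / 2) (by positivity)
  set η := min η₀ 1
  have hη : 0 < η := lt_min hη₀ one_pos
  set K := η⁻¹ * (2 * M)
  have hK : 0 ≤ K := by positivity
  set B : ℝ → ℝ := fun α =>
    e / 2 * ((b - a) ^ α / Real.Gamma (α + 1)) + K * (b - a) * (α / Real.Gamma (α + 1)) +
      M * (|δ ^ α / Real.Gamma (α + 1) - 1| + |(b - a) ^ α / Real.Gamma (α + 1) - 1|)
  have hB : Filter.Tendsto B (nhds 0) (nhds (e / 2)) := by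
    have hb := tendsto_rpow_div_Gamma_add_one (sub_pos.2 hab)
    have hd := tendsto_rpow_div_Gamma_add_one hδ
    simpa using ((hb.const_mul (e / 2)).add
      (tendsto_div_Gamma_add_one.const_mul (K * (b - a)))).add
      (((hd.sub_const 1).abs.add (hb.sub_const 1).abs).const_mul M)
  filter_upwards [(hB.comp hlim).eventually_lt_const (half_lt_self he),
    hlim.eventually_le_const one_pos] with k hkB hk1
  rw [Real.dist_eq, sub_zero, abs_of_nonneg (Real.iSup_nonneg fun _ => abs_nonneg _)]
  have : Nonempty (Set.Icc (a + δ) b) := ⟨⟨b, hδb, le_rfl⟩⟩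
  refine (ciSup_le ?_).trans_lt hkB
  rintro ⟨t, hδt, htb⟩
  have hα := hαk k
  simp only [Function.comp_apply, B]
  set α := αk k
  have hG : 0 < Real.Gamma (α + 1) := Real.Gamma_pos_of_pos (by linarith)
  have hat : a ≤ t := by linarith
  have hta : 0 ≤ t - a := by linarith
  have hmain := abs_rlInt_sub_le_s2 (ε := e / 2) (K := K) hat hα
    (hf.mono (Set.Icc_subset_Icc_right htb)) fun τ hτ =>
      rpow_mul_abs_sub_le (sub_nonneg.2 hτ.2) hη (min_le_right _ _) hα hk1 (by positivity)
        (hM τ ⟨hτ.1, hτ.2.trans htb⟩) (hM t ⟨hat, htb⟩) fun hlt => by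
          refine (hclose τ ⟨hτ.1, hτ.2.trans htb⟩ t ⟨hat, htb⟩ ?_).le
          rw [dist_comm, Real.dist_eq, abs_of_nonneg (sub_nonneg.2 hτ.2)]
          exact hlt.trans_le (min_le_left _ _)
  have hlow : δ ^ α / Real.Gamma (α + 1) ≤ (t - a) ^ α / Real.Gamma (α + 1) := by
    gcongr; linarith
  have hupp : (t - a) ^ α / Real.Gamma (α + 1) ≤ (b - a) ^ α / Real.Gamma (α + 1) := by
    gcongr
  have hone := abs_sub_le_abs_add_abs (c := 1) hlow hupp
  calc |rlInt a α f t - f t|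
      = |(rlInt a α f t - f t * ((t - a) ^ α / Real.Gamma (α + 1)))
          + f t * ((t - a) ^ α / Real.Gamma (α + 1) - 1)| := by congr 1; ring
    _ ≤ _ := abs_add_le _ _
    _ ≤ _ := by
      refine add_le_add (hmain.trans (by gcongr)) ?_
      rw [abs_mul]
      exact mul_le_mul (hM t ⟨hat, htb⟩) hone (abs_nonneg _) hM0
end

section
/- Under the Volterra system setup, for every t ∈ [0,T], |ŷ(t) − ỹ(t)| ≤ C_ε · ‖J^ε_0 z̃ − z̃‖_∞, where C_ε := T L C²_ε E_{α₂−1}(L C¹_ε T^{α₂−1}) + T^{1−ε}/Γ(2−ε), with C¹_ε := (Γ(α₂−1)/Γ(α₂−1+ε)) T^ε + (Γ(α₂−1)/Γ(α₂)) T and C²_ε := T^{α₂−ε}/Γ(α₂−ε+1) + T^{α₂−1}/Γ(α₂). -/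
/-- The Mittag-Leffler function `E_α(x) = ∑_{n=0}^∞ x^n / Γ(nα + 1)`. -/
noncomputable def mittagLeffler (α x : ℝ) : ℝ :=
  ∑' n : ℕ, x ^ n / Real.Gamma (n * α + 1)

section FractionalIntegral

open MeasureTheory Set Filter Topology

/-- The power `t ^ b`, normalised so that `J^a` maps the function of index `b` to that of index
`b + a`. -/
noncomputable def fracPow (b t : ℝ) : ℝ := t ^ b / Real.Gamma (b + 1)

lemma fracPow_zero (t : ℝ) : fracPow 0 t = 1 := by simp [fracPow]

lemma fracPow_nonneg {b t : ℝ} (hb : 0 ≤ b) (ht : 0 ≤ t) : 0 ≤ fracPow b t :=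
  div_nonneg (Real.rpow_nonneg ht b) (Real.Gamma_pos_of_pos (by linarith)).le

lemma fracPow_mono {b t u : ℝ} (hb : 0 ≤ b) (ht : 0 ≤ t) (htu : t ≤ u) :
    fracPow b t ≤ fracPow b u :=
  div_le_div_of_nonneg_right (Real.rpow_le_rpow ht htu hb)
    (Real.Gamma_pos_of_pos (by linarith)).le

/-- `h` is integrable against the kernel of `J^a` on `[0, t]`, and `J^a h (t) = v`. -/
def HasRLInt (a : ℝ) (h : ℝ → ℝ) (t v : ℝ) : Prop :=
  IntervalIntegrable (fun τ => (t - τ) ^ (a - 1) * h τ) volume 0 t ∧ rlInt 0 a h t = v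

lemma intervalIntegrable_rlKernel {a : ℝ} (ha : 0 < a) (t : ℝ) :
    IntervalIntegrable (fun τ => (t - τ) ^ (a - 1)) volume 0 t := by
  have h := (intervalIntegral.intervalIntegrable_rpow' (a := t) (b := 0) (r := a - 1)
    (by linarith)).comp_sub_left t
  simpa using h

lemma ContinuousOn.hasRLInt {a t : ℝ} {h : ℝ → ℝ} (ha : 0 < a) (ht : 0 ≤ t)
    (hh : ContinuousOn h (Icc 0 t)) : HasRLInt a h t (rlInt 0 a h t) :=
  ⟨(intervalIntegrable_rlKernel ha t).mul_continuousOn (by rwa [uIcc_of_le ht]), rfl⟩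

lemma HasRLInt.add {a t v₁ v₂ : ℝ} {h₁ h₂ : ℝ → ℝ} (H₁ : HasRLInt a h₁ t v₁)
    (H₂ : HasRLInt a h₂ t v₂) : HasRLInt a (fun τ => h₁ τ + h₂ τ) t (v₁ + v₂) := by
  refine ⟨by simpa only [mul_add] using H₁.1.add H₂.1, ?_⟩
  rw [← H₁.2, ← H₂.2]
  simp only [rlInt, mul_add]
  rw [intervalIntegral.integral_add H₁.1 H₂.1, mul_add]

lemma HasRLInt.const_mul {a t v : ℝ} {h : ℝ → ℝ} (c : ℝ) (H : HasRLInt a h t v) :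
    HasRLInt a (fun τ => c * h τ) t (c * v) := by
  have e : (fun τ => (t - τ) ^ (a - 1) * (c * h τ)) = fun τ => c * ((t - τ) ^ (a - 1) * h τ) := by
    ext; ring
  refine ⟨by rw [e]; exact H.1.const_mul c, ?_⟩
  rw [← H.2, rlInt, rlInt, e, intervalIntegral.integral_const_mul]
  ring

lemma HasRLInt.sub {a t v₁ v₂ : ℝ} {h₁ h₂ : ℝ → ℝ} (H₁ : HasRLInt a h₁ t v₁)
    (H₂ : HasRLInt a h₂ t v₂) : HasRLInt a (fun τ => h₁ τ - h₂ τ) t (v₁ - v₂) := by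
  simpa [sub_eq_add_neg] using H₁.add (H₂.const_mul (-1))

lemma HasRLInt.sum {ι : Type*} {a t : ℝ} (s : Finset ι) {h : ι → ℝ → ℝ} {v : ι → ℝ}
    (H : ∀ i ∈ s, HasRLInt a (h i) t (v i)) :
    HasRLInt a (fun τ => ∑ i ∈ s, h i τ) t (∑ i ∈ s, v i) := by
  classical
  induction s using Finset.induction_on with
  | empty => simp [HasRLInt, rlInt]
  | insert i s hi ih =>
    simp only [Finset.sum_insert hi]
    exact (H i (by simp)).add (ih fun j hj => H j (by simp [hj]))

lemma HasRLInt.abs_le {a t v : ℝ} {h k : ℝ → ℝ} (H : HasRLInt a k t v) (ha : 0 < a) (ht : 0 ≤ t)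
    (hk : ∀ τ ∈ Icc 0 t, |h τ| ≤ k τ) : |rlInt 0 a h t| ≤ v := by
  have hΓ : 0 < 1 / Real.Gamma a := one_div_pos.2 (Real.Gamma_pos_of_pos ha)
  rw [← H.2, rlInt, rlInt, abs_mul, abs_of_pos hΓ]
  refine mul_le_mul_of_nonneg_left ?_ hΓ.le
  rw [← Real.norm_eq_abs]
  refine intervalIntegral.norm_integral_le_of_norm_le ht (.of_forall fun τ hτ => ?_) H.1
  have hp : 0 ≤ (t - τ) ^ (a - 1) := Real.rpow_nonneg (by linarith [hτ.2]) _
  rw [Real.norm_eq_abs, abs_mul, abs_of_nonneg hp]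
  exact mul_le_mul_of_nonneg_left (hk τ ⟨hτ.1.le, hτ.2⟩) hp

lemma integral_sub_rpow_mul_rpow {a b t : ℝ} (ha : 0 < a) (hb : 0 < b) (ht : 0 < t) :
    ∫ τ in (0 : ℝ)..t, (t - τ) ^ (a - 1) * τ ^ (b - 1) =
      t ^ (a + b - 1) * (Real.Gamma a * Real.Gamma b / Real.Gamma (a + b)) := by
  have h := Complex.betaIntegral_scaled (b : ℂ) (a : ℂ) ht
  have hB : Complex.betaIntegral b a =
      ((Real.Gamma a * Real.Gamma b / Real.Gamma (a + b) : ℝ) : ℂ) := by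
    rw [Complex.betaIntegral_eq_Gamma_mul_div _ _ (by simpa) (by simpa), ← Complex.ofReal_add]
    simp only [Complex.Gamma_ofReal]
    push_cast
    rw [mul_comm, add_comm b a]
  rw [hB] at h
  apply Complex.ofReal_injective
  rw [← intervalIntegral.integral_ofReal]
  have hp : ((t ^ (a + b - 1) : ℝ) : ℂ) = (t : ℂ) ^ ((b : ℂ) + a - 1) := by
    rw [Complex.ofReal_cpow ht.le]
    push_cast
    rw [add_comm (a : ℂ)]
  rw [Complex.ofReal_mul, hp, ← h]
  refine intervalIntegral.integral_congr fun τ hτ => ?_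
  rw [uIcc_of_le ht.le] at hτ
  rw [Complex.ofReal_mul, Complex.ofReal_cpow hτ.1, Complex.ofReal_cpow (sub_nonneg.2 hτ.2)]
  push_cast
  ring

lemma hasRLInt_fracPow {a b t : ℝ} (ha : 0 < a) (hb : 0 ≤ b) (ht : 0 ≤ t) :
    HasRLInt a (fracPow b) t (fracPow (b + a) t) := by
  have hc : ContinuousOn (fracPow b) (Icc 0 t) :=
    ((Real.continuous_rpow_const hb).div_const _).continuousOn
  refine ⟨(hc.hasRLInt ha ht).1, ?_⟩
  rcases ht.eq_or_lt with rfl | ht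
  · simp [rlInt, fracPow, Real.zero_rpow (show b + a ≠ 0 by linarith)]
  have h := integral_sub_rpow_mul_rpow ha (show 0 < b + 1 by linarith) ht
  simp only [add_sub_cancel_right] at h
  simp only [rlInt, fracPow, ← mul_div_assoc]
  rw [intervalIntegral.integral_div, h, show a + (b + 1) - 1 = b + a by ring,
    show a + (b + 1) = b + a + 1 by ring]
  have h1 := (Real.Gamma_pos_of_pos ha).ne'
  have h2 := (Real.Gamma_pos_of_pos (show 0 < b + 1 by linarith)).ne'
  field_simp

lemma fracPow_add_le {a b σ t T : ℝ} (ha : 0 < a) (hb : 0 ≤ b) (hσ : 0 ≤ σ) (ht : 0 ≤ t)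
    (htT : t ≤ T) :
    fracPow (b + (a + σ)) t ≤ Real.Gamma a / Real.Gamma (a + σ) * T ^ σ * fracPow (b + a) t := by
  have h1 := hasRLInt_fracPow (show 0 < a + σ by linarith) hb ht
  have h2 := hasRLInt_fracPow ha hb ht
  have hΓ := Real.Gamma_pos_of_pos ha
  have hΓ' := Real.Gamma_pos_of_pos (show 0 < a + σ by linarith)
  rw [← h1.2, ← h2.2, rlInt, rlInt]
  have : (∫ τ in (0 : ℝ)..t, (t - τ) ^ (a + σ - 1) * fracPow b τ) ≤
      T ^ σ * ∫ τ in (0 : ℝ)..t, (t - τ) ^ (a - 1) * fracPow b τ := by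
    rw [← intervalIntegral.integral_const_mul]
    refine intervalIntegral.integral_mono_on_of_le_Ioo ht h1.1 (h2.1.const_mul _) fun τ hτ => ?_
    have hp : 0 < t - τ := by linarith [hτ.2]
    rw [show a + σ - 1 = σ + (a - 1) by ring, Real.rpow_add hp, mul_assoc]
    refine mul_le_mul_of_nonneg_right
      (Real.rpow_le_rpow hp.le (by linarith [hτ.1]) hσ)
      (mul_nonneg (Real.rpow_nonneg hp.le _) (fracPow_nonneg hb hτ.1.le))
  calc _ ≤ 1 / Real.Gamma (a + σ) *
        (T ^ σ * ∫ τ in (0 : ℝ)..t, (t - τ) ^ (a - 1) * fracPow b τ) :=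
        mul_le_mul_of_nonneg_left this (by positivity)
    _ = _ := by field_simp

lemma Real.rpow_mul_Gamma_le_Gamma_add {x a : ℝ} (hx : 1 < x) (ha : 0 < a) :
    (x - 1) ^ a * Real.Gamma x ≤ Real.Gamma (x + a) := by
  have hx1 : 0 < x - 1 := by linarith
  have h := Real.convexOn_log_Gamma.slope_mono_adjacent (x := x - 1) (y := x) (z := x + a)
    (mem_Ioi.2 hx1) (mem_Ioi.2 (by linarith)) (by linarith) (by linarith)
  have hg1 := Real.Gamma_pos_of_pos hx1
  have hg2 := Real.Gamma_pos_of_pos (show 0 < x by linarith)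
  have hg3 := Real.Gamma_pos_of_pos (show 0 < x + a by linarith)
  have hrec : Real.Gamma x = (x - 1) * Real.Gamma (x - 1) := by
    simpa using Real.Gamma_add_one hx1.ne'
  simp only [Function.comp, sub_sub_cancel, div_one, add_sub_cancel_left] at h
  rw [le_div_iff₀ ha] at h
  have hl : Real.log (Real.Gamma x) = Real.log (x - 1) + Real.log (Real.Gamma (x - 1)) := by
    rw [hrec, Real.log_mul hx1.ne' hg1.ne']
  rw [← Real.log_le_log_iff (by positivity) hg3, Real.log_mul (by positivity) hg2.ne',
    Real.log_rpow hx1]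
  rw [hl] at h ⊢
  nlinarith

lemma summable_mittagLeffler {a x : ℝ} (ha : 0 < a) :
    Summable fun n : ℕ => x ^ n / Real.Gamma (n * a + 1) := by
  rcases eq_or_ne x 0 with rfl | hx
  · exact summable_of_ne_finset_zero (s := {0}) fun n hn => by
      simp [zero_pow (by simpa using hn)]
  have hpos : ∀ n : ℕ, 0 < Real.Gamma (n * a + 1) := fun n =>
    Real.Gamma_pos_of_pos (by positivity)
  refine summable_of_ratio_test_tendsto_lt_one zero_lt_one
    (.of_forall fun n => div_ne_zero (pow_ne_zero n hx) (hpos n).ne') ?_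
  have hlim : Tendsto (fun n : ℕ => |x| / ((n : ℝ) * a) ^ a) atTop (𝓝 0) :=
    Tendsto.const_div_atTop ((tendsto_rpow_atTop ha).comp
      (tendsto_natCast_atTop_atTop.atTop_mul_const ha)) _
  refine squeeze_zero' (.of_forall fun n => by positivity) ?_ hlim
  filter_upwards [eventually_gt_atTop 0] with n hn
  have hna : 0 < (n : ℝ) * a := by positivity
  have hG := Real.rpow_mul_Gamma_le_Gamma_add (x := n * a + 1) (a := a) (by linarith) ha
  rw [add_sub_cancel_right] at hG
  have hn1 := hpos (n + 1)
  have e : ((n + 1 : ℕ) : ℝ) * a + 1 = n * a + 1 + a := by push_cast; ring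
  rw [e] at hn1 ⊢
  have hn0 := hpos n
  have hxp : 0 < |x| := abs_pos.2 hx
  have hr : 0 < ((n : ℝ) * a) ^ a := by positivity
  rw [norm_div, norm_div, norm_pow, norm_pow, Real.norm_eq_abs, Real.norm_eq_abs,
    Real.norm_eq_abs, abs_of_pos hn1, abs_of_pos hn0, div_div_div_eq,
    div_le_div_iff₀ (by positivity) hr]
  calc _ = |x| * |x| ^ n * (((n : ℝ) * a) ^ a * Real.Gamma (n * a + 1)) := by ring
    _ ≤ |x| * |x| ^ n * Real.Gamma (n * a + 1 + a) := by gcongr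
    _ = _ := by ring

end FractionalIntegral

theorem stmt11 (T α₂ ε s y₀ L : ℝ) (f : ℝ → ℝ → ℝ → ℝ)
    (yh w z yt zt : ℝ → ℝ)
    (hT : 0 < T) (hα₂ : 1 < α₂) (hα₂' : α₂ < 2) (hε : 0 < ε) (hε1 : ε < 1) (hL : 0 < L)
    (hfc : Continuous fun p : ℝ × ℝ × ℝ => f p.1 p.2.1 p.2.2)
    (hlip : ∀ t ∈ Set.Icc (0:ℝ) T, ∀ x₁ x₂ y₁ y₂ : ℝ,
      |f t x₁ y₁ - f t x₂ y₂| ≤ L * (|x₁ - x₂| + |y₁ - y₂|))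
    (hyh : ContinuousOn yh (Set.Icc 0 T)) (hw : ContinuousOn w (Set.Icc 0 T))
    (hz : ContinuousOn z (Set.Icc 0 T)) (hyt : ContinuousOn yt (Set.Icc 0 T))
    (hzt : ContinuousOn zt (Set.Icc 0 T))
    (heq1 : ∀ t ∈ Set.Icc (0:ℝ) T, yh t = y₀ + rlInt 0 (1 - ε) w t)
    (heq2 : ∀ t ∈ Set.Icc (0:ℝ) T, w t = rlInt 0 ε z t)
    (heq3 : ∀ t ∈ Set.Icc (0:ℝ) T,
      z t = s + rlInt 0 (α₂ - 1) (fun τ => f τ (yh τ) (w τ)) t)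
    (heq4 : ∀ t ∈ Set.Icc (0:ℝ) T, yt t = y₀ + rlInt 0 (1 - ε) zt t)
    (heq5 : ∀ t ∈ Set.Icc (0:ℝ) T,
      zt t = s + rlInt 0 (α₂ - 1) (fun τ => f τ (yt τ) (zt τ)) t) :
    ∀ t ∈ Set.Icc (0:ℝ) T,
      |yh t - yt t| ≤
        (T * (L * (T ^ (α₂ - ε) / Real.Gamma (α₂ - ε + 1) + T ^ (α₂ - 1) / Real.Gamma α₂)) *
            mittagLeffler (α₂ - 1)
              (L * (Real.Gamma (α₂ - 1) / Real.Gamma (α₂ - 1 + ε) * T ^ ε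
                  + Real.Gamma (α₂ - 1) / Real.Gamma α₂ * T) * T ^ (α₂ - 1))
          + T ^ (1 - ε) / Real.Gamma (2 - ε)) *
          (⨆ τ : Set.Icc (0:ℝ) T, |rlInt 0 ε zt τ - zt τ|) := by
  set α := α₂ - 1 with hα_def
  have hα : 0 < α := by simp only [hα_def]; linarith
  have hΓα := Real.Gamma_pos_of_pos hα
  set δ := ⨆ τ : Set.Icc (0:ℝ) T, |rlInt 0 ε zt τ - zt τ| with hδ_def
  have hδ0 : 0 ≤ δ := Real.iSup_nonneg fun _ => abs_nonneg _
  have hsub : ∀ t ∈ Set.Icc (0:ℝ) T, Set.Icc 0 t ⊆ Set.Icc 0 T := fun t ht =>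
    Set.Icc_subset_Icc_right ht.2
  have hδ : ∀ t ∈ Set.Icc (0:ℝ) T, |rlInt 0 ε zt t - zt t| ≤ δ := by
    obtain ⟨B, hB⟩ := isCompact_Icc.exists_bound_of_continuousOn hzt
    intro t ht
    refine le_ciSup (f := fun τ : Set.Icc (0:ℝ) T => |rlInt 0 ε zt τ - zt τ|) ?_ ⟨t, ht⟩
    refine ⟨B * fracPow (0 + ε) T + B, ?_⟩
    rintro _ ⟨⟨τ, hτ⟩, rfl⟩
    have hB0 : 0 ≤ B := (norm_nonneg _).trans (hB τ hτ)
    have h1 := ((hasRLInt_fracPow hε le_rfl hτ.1).const_mul B).abs_le (h := zt) hε hτ.1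
      fun u hu => by
        rw [fracPow_zero, mul_one]
        exact hB u (hsub τ hτ hu)
    have h2 : B * fracPow (0 + ε) τ ≤ B * fracPow (0 + ε) T :=
      mul_le_mul_of_nonneg_left (fracPow_mono (by linarith) hτ.1 hτ.2) hB0
    exact (abs_sub _ _).trans (add_le_add (h1.trans h2) (hB τ hτ))
  obtain ⟨M, hM⟩ := isCompact_Icc.exists_bound_of_continuousOn (hz.sub hzt)
  have hM0 : 0 ≤ M := (norm_nonneg _).trans (hM 0 ⟨le_rfl, hT.le⟩)
  -- A bound on `z - zt` by powers propagates to `w - zt` and to `yh - yt`.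
  have hwz : ∀ (N : ℕ) (c b : ℕ → ℝ), (∀ k, 0 ≤ b k) →
      (∀ t ∈ Set.Icc (0:ℝ) T, |z t - zt t| ≤ ∑ k ∈ Finset.range N, c k * fracPow (b k) t) →
      ∀ t ∈ Set.Icc (0:ℝ) T, |w t - zt t| ≤
        ∑ k ∈ Finset.range N, c k * fracPow (b k + ε) t + δ * fracPow 0 t := by
    intro N c b hb he t ht
    have h1 := (HasRLInt.sum (Finset.range N) fun k _ =>
      (hasRLInt_fracPow hε (hb k) ht.1).const_mul (c k)).abs_le (h := fun τ => z τ - zt τ) hε ht.1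
      fun τ hτ => he τ (hsub t ht hτ)
    rw [(((hz.mono (hsub t ht)).hasRLInt hε ht.1).sub
      ((hzt.mono (hsub t ht)).hasRLInt hε ht.1)).2] at h1
    rw [heq2 t ht, fracPow_zero, mul_one]
    calc _ = |(rlInt 0 ε z t - rlInt 0 ε zt t) + (rlInt 0 ε zt t - zt t)| := by ring_nf
      _ ≤ _ := (abs_add_le _ _).trans (add_le_add h1 (hδ t ht))
  have hyy : ∀ (N : ℕ) (c b : ℕ → ℝ), (∀ k, 0 ≤ b k) →
      (∀ t ∈ Set.Icc (0:ℝ) T, |z t - zt t| ≤ ∑ k ∈ Finset.range N, c k * fracPow (b k) t) →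
      ∀ t ∈ Set.Icc (0:ℝ) T, |yh t - yt t| ≤
        ∑ k ∈ Finset.range N, c k * fracPow (b k + 1) t + δ * fracPow (1 - ε) t := by
    intro N c b hb he t ht
    have hε' : 0 < 1 - ε := by linarith
    have h1 := ((HasRLInt.sum (Finset.range N) fun k _ =>
      (hasRLInt_fracPow hε' (add_nonneg (hb k) hε.le) ht.1).const_mul (c k)).add
        ((hasRLInt_fracPow hε' le_rfl ht.1).const_mul δ)).abs_le (h := fun τ => w τ - zt τ) hε' ht.1
      fun τ hτ => hwz N c b hb he τ (hsub t ht hτ)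
    rw [(((hw.mono (hsub t ht)).hasRLInt hε' ht.1).sub
      ((hzt.mono (hsub t ht)).hasRLInt hε' ht.1)).2] at h1
    simp only [add_assoc, add_sub_cancel, zero_add] at h1
    rwa [heq1 t ht, heq4 t ht, add_sub_add_left_eq_sub]
  set C1 := Real.Gamma α / Real.Gamma (α + ε) * T ^ ε + Real.Gamma α / Real.Gamma α₂ * T
    with hC1
  set C2 := T ^ (α₂ - ε) / Real.Gamma (α₂ - ε + 1) + T ^ α / Real.Gamma α₂ with hC2
  have hC1_nonneg : 0 ≤ C1 := by
    have h1 := Real.Gamma_pos_of_pos (show 0 < α + ε by linarith)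
    have h2 := Real.Gamma_pos_of_pos (show 0 < α₂ by linarith)
    positivity
  have hC2_nonneg : 0 ≤ C2 := by
    have h1 := Real.Gamma_pos_of_pos (show 0 < α₂ - ε + 1 by linarith)
    have h2 := Real.Gamma_pos_of_pos (show 0 < α₂ by linarith)
    positivity
  have hC2' : fracPow (1 - ε + α) T + fracPow α T = C2 := by
    simp only [fracPow, hC2, hα_def]
    ring_nf
  have hF : ∀ u v : ℝ → ℝ, ContinuousOn u (Set.Icc 0 T) → ContinuousOn v (Set.Icc 0 T) →
      ContinuousOn (fun τ => f τ (u τ) (v τ)) (Set.Icc 0 T) := fun u v hu hv =>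
    hfc.comp_continuousOn (continuousOn_id.prodMk (hu.prodMk hv))
  have hstep : ∀ (N : ℕ) (c b : ℕ → ℝ), (∀ k, 0 ≤ c k) → (∀ k, 0 ≤ b k) →
      (∀ t ∈ Set.Icc (0:ℝ) T, |z t - zt t| ≤ ∑ k ∈ Finset.range N, c k * fracPow (b k) t) →
      ∀ t ∈ Set.Icc (0:ℝ) T, |z t - zt t| ≤
        ∑ k ∈ Finset.range N, L * C1 * c k * fracPow (b k + α) t + L * δ * C2 := by
    intro N c b hc hb he t ht
    have hε' : 0 ≤ 1 - ε := by linarith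
    have h1 := ((((HasRLInt.sum (Finset.range N) fun k _ =>
      (hasRLInt_fracPow hα (add_nonneg (hb k) zero_le_one) ht.1).const_mul (c k)).add
        ((hasRLInt_fracPow hα hε' ht.1).const_mul δ)).add
      ((HasRLInt.sum (Finset.range N) fun k _ =>
      (hasRLInt_fracPow hα (add_nonneg (hb k) hε.le) ht.1).const_mul (c k)).add
        ((hasRLInt_fracPow hα le_rfl ht.1).const_mul δ))).const_mul L).abs_le
      (h := fun τ => f τ (yh τ) (w τ) - f τ (yt τ) (zt τ)) hα ht.1
      fun τ hτ => (hlip τ (hsub t ht hτ) _ _ _ _).trans (mul_le_mul_of_nonneg_left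
        (add_le_add (hyy N c b hb he τ (hsub t ht hτ)) (hwz N c b hb he τ (hsub t ht hτ))) hL.le)
    rw [((((hF yh w hyh hw).mono (hsub t ht)).hasRLInt hα ht.1).sub
      (((hF yt zt hyt hzt).mono (hsub t ht)).hasRLInt hα ht.1)).2] at h1
    rw [heq3 t ht, heq5 t ht, add_sub_add_left_eq_sub]
    refine h1.trans ?_
    have h2 : ∑ k ∈ Finset.range N, c k * fracPow (b k + 1 + α) t +
        ∑ k ∈ Finset.range N, c k * fracPow (b k + ε + α) t ≤
        ∑ k ∈ Finset.range N, C1 * c k * fracPow (b k + α) t := by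
      rw [← Finset.sum_add_distrib]
      refine Finset.sum_le_sum fun k _ => ?_
      have e1 := fracPow_add_le hα (hb k) zero_le_one ht.1 ht.2
      have e2 := fracPow_add_le hα (hb k) hε.le ht.1 ht.2
      rw [Real.rpow_one, show α + 1 = α₂ by simp [hα_def]] at e1
      rw [show b k + 1 + α = b k + α₂ by simp only [hα_def]; ring,
        show b k + ε + α = b k + (α + ε) by ring]
      calc _ = c k * (fracPow (b k + α₂) t + fracPow (b k + (α + ε)) t) := by ring
        _ ≤ c k * (Real.Gamma α / Real.Gamma α₂ * T * fracPow (b k + α) t +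
            Real.Gamma α / Real.Gamma (α + ε) * T ^ ε * fracPow (b k + α) t) :=
          mul_le_mul_of_nonneg_left (add_le_add e1 e2) (hc k)
        _ = _ := by rw [hC1]; ring
    have h3 : δ * fracPow (1 - ε + α) t + δ * fracPow (0 + α) t ≤ δ * C2 := by
      rw [← mul_add, ← hC2', zero_add]
      exact mul_le_mul_of_nonneg_left (add_le_add (fracPow_mono (by linarith) ht.1 ht.2)
        (fracPow_mono hα.le ht.1 ht.2)) hδ0
    have h4 := mul_le_mul_of_nonneg_left (add_le_add h2 h3) hL.le
    have h5 : ∑ k ∈ Finset.range N, L * C1 * c k * fracPow (b k + α) t =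
        L * ∑ k ∈ Finset.range N, C1 * c k * fracPow (b k + α) t := by
      rw [Finset.mul_sum]
      exact Finset.sum_congr rfl fun k _ => by ring
    rw [h5]
    linarith
  set A := L * δ * C2 with hA
  have hA0 : 0 ≤ A := by positivity
  have hiter : ∀ n : ℕ, ∀ t ∈ Set.Icc (0:ℝ) T, |z t - zt t| ≤ ∑ k ∈ Finset.range (n + 1),
      (L * C1) ^ k * (if k < n then A else M) * fracPow (k * α) t := by
    intro n
    induction n with
    | zero =>
      intro t ht
      simpa [fracPow_zero] using hM t ht
    | succ n ih =>
      intro t ht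
      have h := hstep (n + 1) (fun k => (L * C1) ^ k * (if k < n then A else M))
        (fun k => k * α) (fun k => by split_ifs <;> positivity) (fun k => by positivity) ih t ht
      rw [Finset.sum_range_succ']
      refine h.trans (le_of_eq ?_)
      congr 1
      · refine Finset.sum_congr rfl fun k _ => ?_
        simp only [add_lt_add_iff_right]
        push_cast
        rw [add_mul (k : ℝ), one_mul]
        ring
      · simp [fracPow_zero]
  set q : ℕ → ℝ := fun n => (L * C1 * T ^ α) ^ n / Real.Gamma (n * α + 1) with hq
  have hq_eq : ∀ k : ℕ, (L * C1) ^ k * fracPow (k * α) T = q k := fun k => by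
    simp only [hq, fracPow]
    rw [mul_pow (L * C1), ← Real.rpow_natCast (T ^ α), ← Real.rpow_mul hT.le, mul_comm α]
    ring
  have hq_nonneg : ∀ k, 0 ≤ q k := fun k => by
    rw [← hq_eq]
    exact mul_nonneg (by positivity) (fracPow_nonneg (by positivity) hT.le)
  have hsum : Summable q := summable_mittagLeffler hα
  have hbound : ∀ t ∈ Set.Icc (0:ℝ) T,
      |z t - zt t| ≤ A * mittagLeffler α (L * C1 * T ^ α) := by
    intro t ht
    have hlim : Filter.Tendsto (fun n => A * mittagLeffler α (L * C1 * T ^ α) + M * q n)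
        Filter.atTop (nhds (A * mittagLeffler α (L * C1 * T ^ α))) := by
      simpa using (hsum.tendsto_atTop_zero.const_mul M).const_add
        (A * mittagLeffler α (L * C1 * T ^ α))
    refine ge_of_tendsto' hlim fun n => (hiter n t ht).trans ?_
    have h1 : ∀ (k : ℕ) (d : ℝ), 0 ≤ d →
        (L * C1) ^ k * d * fracPow (k * α) t ≤ d * q k := fun k d hd => by
      rw [← hq_eq]
      calc _ ≤ (L * C1) ^ k * d * fracPow (k * α) T :=
            mul_le_mul_of_nonneg_left (fracPow_mono (by positivity) ht.1 ht.2) (by positivity)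
        _ = _ := by ring
    rw [Finset.sum_range_succ, if_neg (lt_irrefl n)]
    refine add_le_add ?_ (h1 n M hM0)
    calc _ ≤ ∑ k ∈ Finset.range n, A * q k := Finset.sum_le_sum fun k hk => by
          rw [if_pos (Finset.mem_range.1 hk)]
          exact h1 k A hA0
      _ = A * ∑ k ∈ Finset.range n, q k := by rw [Finset.mul_sum]
      _ ≤ _ := mul_le_mul_of_nonneg_left (hsum.sum_le_tsum _ fun k _ => hq_nonneg k) hA0
  intro t ht
  set K := A * mittagLeffler α (L * C1 * T ^ α) with hK
  have hK0 : 0 ≤ K := (abs_nonneg _).trans (hbound t ht)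
  have h := hyy 1 (fun _ => K) (fun _ => 0) (fun _ => le_rfl)
    (fun t ht => by simpa [fracPow_zero] using hbound t ht) t ht
  have e1 : fracPow 1 T = T := by simp [fracPow, one_add_one_eq_two]
  have e2 : fracPow (1 - ε) T = T ^ (1 - ε) / Real.Gamma (2 - ε) := by
    rw [fracPow]
    congr 2
    ring
  simp only [Finset.sum_range_one, zero_add] at h
  calc |yh t - yt t| ≤ K * fracPow 1 t + δ * fracPow (1 - ε) t := h
    _ ≤ K * fracPow 1 T + δ * fracPow (1 - ε) T := add_le_add
        (mul_le_mul_of_nonneg_left (fracPow_mono zero_le_one ht.1 ht.2) hK0)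
        (mul_le_mul_of_nonneg_left (fracPow_mono (by linarith) ht.1 ht.2) hδ0)
    _ = _ := by rw [e1, e2, hK, hA]; ring
end

section
/- Fix T > 0, 1 < α₂ < 2, s, y₀ ∈ ℝ, L > 0, and a continuous f : [0,T] × ℝ × ℝ → ℝ satisfying |f(t,x₁,y₁) − f(t,x₂,y₂)| ≤ L(|x₁−x₂| + |y₁−y₂|) for all t ∈ [0,T] and all x₁,x₂,y₁,y₂ ∈ ℝ. Let (ε_k) be a sequence in (0, 1/2] with ε_k → 0, and for each k let ŷ_k, w_k, z_k, ỹ_k, z̃_k : [0,T] → ℝ be continuous functions satisfying the Volterra system with parameter ε = ε_k: ŷ_k(t) = y₀ + J^{1−ε_k}_0 w_k(t), w_k(t) = J^{ε_k}_0 z_k(t), z_k(t) = s + J^{α₂−1}_0 [f(·, ŷ_k(·), w_k(·))](t), ỹ_k(t) = y₀ + J^{1−ε_k}_0 z̃_k(t), z̃_k(t) = s + J^{α₂−1}_0 [f(·, ỹ_k(·), z̃_k(·))](t) for all t ∈ [0,T]. If moreover ‖J^{ε_k}_0 z̃_k − z̃_k‖_∞ → 0 as k → ∞, then sup_{t ∈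 [0,T]} |ŷ_k(t) − ỹ_k(t)| → 0 as k → ∞. -/
open MeasureTheory Set in
/-- The Riemann–Liouville kernel is integrable against a continuous function. -/
theorem intervalIntegrable_rlKernel_mul {α t : ℝ} (hα : 0 < α) (ht : 0 ≤ t) {g : ℝ → ℝ}
    (hg : ContinuousOn g (Icc 0 t)) :
    IntervalIntegrable (fun τ => (t - τ) ^ (α - 1) * g τ) volume 0 t := by
  have h : IntervalIntegrable (fun τ : ℝ => (t - τ) ^ (α - 1)) volume 0 t := by
    have := (intervalIntegral.intervalIntegrable_rpow' (a := t) (b := 0)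
      (show -1 < α - 1 by linarith)).comp_sub_left t
    simpa using this
  exact h.mul_continuousOn (by rwa [uIcc_of_le ht])

theorem rlInt_sub {α t : ℝ} (hα : 0 < α) (ht : 0 ≤ t) {g h : ℝ → ℝ}
    (hg : ContinuousOn g (Set.Icc 0 t)) (hh : ContinuousOn h (Set.Icc 0 t)) :
    rlInt 0 α (fun τ => g τ - h τ) t = rlInt 0 α g t - rlInt 0 α h t := by
  simp only [rlInt, mul_sub]
  rw [intervalIntegral.integral_sub (intervalIntegrable_rlKernel_mul hα ht hg)
    (intervalIntegrable_rlKernel_mul hα ht hh)]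
  ring

open MeasureTheory Set in
/-- In the exponentially weighted sup norm with rate `l`, the operator `rlInt 0 α` has norm
at most `l ^ (-α)`. -/
theorem abs_rlInt_le_of_abs_le_exp {α l t M : ℝ} (hα : 0 < α) (hl : 0 < l) (ht : 0 ≤ t)
    (hM : 0 ≤ M) {g : ℝ → ℝ} (hg : ∀ τ ∈ Icc 0 t, |g τ| ≤ M * Real.exp (l * τ)) :
    |rlInt 0 α g t| ≤ l ^ (-α) * (M * Real.exp (l * t)) := by
  have hΓ := Real.Gamma_pos_of_pos hα
  have hbound : ‖∫ τ in (0 : ℝ)..t, (t - τ) ^ (α - 1) * g τ‖ ≤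
      ∫ τ in (0 : ℝ)..t, (t - τ) ^ (α - 1) * (M * Real.exp (l * τ)) := by
    refine intervalIntegral.norm_integral_le_of_norm_le ht (ae_of_all _ fun τ hτ => ?_)
      (intervalIntegrable_rlKernel_mul hα ht (by fun_prop))
    have h0 : 0 ≤ (t - τ) ^ (α - 1) := Real.rpow_nonneg (by linarith [hτ.2]) _
    rw [norm_mul, Real.norm_eq_abs, Real.norm_eq_abs, abs_of_nonneg h0]
    exact mul_le_mul_of_nonneg_left (hg τ ⟨hτ.1.le, hτ.2⟩) h0
  have hsubst : ∫ τ in (0 : ℝ)..t, (t - τ) ^ (α - 1) * (M * Real.exp (l * τ)) =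
      M * Real.exp (l * t) * ∫ u in (0 : ℝ)..t, u ^ (α - 1) * Real.exp (-(l * u)) := by
    have h := intervalIntegral.integral_comp_sub_left (a := 0) (b := t)
      (fun u : ℝ => M * Real.exp (l * t) * (u ^ (α - 1) * Real.exp (-(l * u)))) t
    rw [sub_self, sub_zero] at h
    rw [← intervalIntegral.integral_const_mul, ← h]
    refine intervalIntegral.integral_congr fun τ _ => ?_
    have : Real.exp (l * τ) = Real.exp (l * t) * Real.exp (-(l * (t - τ))) := by
      rw [← Real.exp_add]; ring_nf
    simp only [this]
    ring
  have hGamma := Real.integral_rpow_mul_exp_neg_mul_Ioi hα hl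
  have hle : ∫ u in (0 : ℝ)..t, u ^ (α - 1) * Real.exp (-(l * u)) ≤
      (1 / l) ^ α * Real.Gamma α := by
    rw [intervalIntegral.integral_of_le ht, ← hGamma]
    refine setIntegral_mono_set ?_ ?_ (LE.le.eventuallyLE Ioc_subset_Ioi_self)
    · exact not_imp_comm.1 integral_undef (by rw [hGamma]; positivity)
    · filter_upwards [ae_restrict_mem measurableSet_Ioi] with u hu
      exact mul_nonneg (Real.rpow_nonneg (le_of_lt hu) _) (Real.exp_pos _).le
  have hpow : (1 / l) ^ α = l ^ (-α) := by
    rw [one_div, Real.inv_rpow hl.le, Real.rpow_neg hl.le]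
  rw [rlInt, abs_mul, abs_of_pos (one_div_pos.2 hΓ), one_div_mul_eq_div, div_le_iff₀ hΓ]
  calc _ ≤ _ := hbound
    _ = _ := hsubst
    _ ≤ M * Real.exp (l * t) * ((1 / l) ^ α * Real.Gamma α) := by gcongr
    _ = _ := by rw [hpow]; ring

/-- For rates `l ≥ 1`, `rlInt 0 α` is a contraction in the exponentially weighted sup norm. -/
theorem abs_rlInt_le_of_abs_le_exp_of_one_le {α l t M : ℝ} (hα : 0 < α) (hl : 1 ≤ l)
    (ht : 0 ≤ t) (hM : 0 ≤ M) {g : ℝ → ℝ}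
    (hg : ∀ τ ∈ Set.Icc 0 t, |g τ| ≤ M * Real.exp (l * τ)) :
    |rlInt 0 α g t| ≤ M * Real.exp (l * t) :=
  (abs_rlInt_le_of_abs_le_exp hα (by linarith) ht hM hg).trans
    (mul_le_of_le_one_left (by positivity)
      (Real.rpow_le_one_of_one_le_of_nonpos hl (by linarith)))

theorem exists_one_le_mul_rpow_neg_le {β c : ℝ} (hβ : 0 < β) :
    ∃ l : ℝ, 1 ≤ l ∧ c * l ^ (-β) ≤ 1 / 2 := by
  have h : Filter.Tendsto (fun l : ℝ => c * l ^ (-β)) Filter.atTop (nhds 0) := by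
    simpa using (tendsto_rpow_neg_atTop hβ).const_mul c
  obtain ⟨l, h1, h2⟩ := ((Filter.eventually_ge_atTop (1 : ℝ)).and
    (h.eventually_le_const (by norm_num : (0 : ℝ) < 1 / 2))).exists
  exact ⟨l, h1, h2⟩

open Set in
theorem bddAbove_abs_rlInt_sub {T α : ℝ} (hα : 0 < α) {g : ℝ → ℝ}
    (hg : ContinuousOn g (Icc 0 T)) :
    BddAbove (range fun τ : Icc (0 : ℝ) T => |rlInt 0 α g τ - g τ|) := by
  obtain ⟨C, hC⟩ := isCompact_Icc.exists_bound_of_continuousOn hg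
  refine ⟨|C| * Real.exp (1 * T) + |C|, ?_⟩
  rintro _ ⟨⟨t, ht⟩, rfl⟩
  have hgC : ∀ τ ∈ Icc (0 : ℝ) T, |g τ| ≤ |C| := fun τ hτ => (hC τ hτ).trans (le_abs_self C)
  have h := abs_rlInt_le_of_abs_le_exp_of_one_le (g := g) hα le_rfl ht.1 (abs_nonneg C)
    fun τ hτ => (hgC τ ⟨hτ.1, hτ.2.trans ht.2⟩).trans
      (le_mul_of_one_le_right (abs_nonneg C) (Real.one_le_exp (by linarith [hτ.1])))
  have hexp : |C| * Real.exp (1 * t) ≤ |C| * Real.exp (1 * T) := by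
    gcongr
    exact ht.2
  exact (abs_sub _ _).trans (add_le_add (h.trans hexp) (hgC t ht))

open Set in
/-- Stability of the Volterra system: the defect `|rlInt 0 ε zt - zt| ≤ δ` controls the distance
between the `y`-components, with a constant depending only on the rate `l` and on `T`. -/
theorem abs_sub_le_of_volterra_system {T β s y₀ L ε l δ : ℝ} {f : ℝ → ℝ → ℝ → ℝ}
    {yh w z yt zt : ℝ → ℝ} (hT : 0 < T) (hβ : 0 < β) (hL : 0 < L)
    (hfc : Continuous fun p : ℝ × ℝ × ℝ => f p.1 p.2.1 p.2.2)
    (hlip : ∀ t ∈ Icc (0 : ℝ) T, ∀ x₁ x₂ y₁ y₂ : ℝ,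
      |f t x₁ y₁ - f t x₂ y₂| ≤ L * (|x₁ - x₂| + |y₁ - y₂|))
    (hε : 0 < ε) (hε1 : ε < 1) (hl : 1 ≤ l) (hlL : 2 * L * l ^ (-β) ≤ 1 / 2)
    (hyh : ContinuousOn yh (Icc 0 T)) (hw : ContinuousOn w (Icc 0 T))
    (hz : ContinuousOn z (Icc 0 T)) (hyt : ContinuousOn yt (Icc 0 T))
    (hzt : ContinuousOn zt (Icc 0 T))
    (heq1 : ∀ t ∈ Icc (0 : ℝ) T, yh t = y₀ + rlInt 0 (1 - ε) w t)
    (heq2 : ∀ t ∈ Icc (0 : ℝ) T, w t = rlInt 0 ε z t)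
    (heq3 : ∀ t ∈ Icc (0 : ℝ) T, z t = s + rlInt 0 β (fun τ => f τ (yh τ) (w τ)) t)
    (heq4 : ∀ t ∈ Icc (0 : ℝ) T, yt t = y₀ + rlInt 0 (1 - ε) zt t)
    (heq5 : ∀ t ∈ Icc (0 : ℝ) T, zt t = s + rlInt 0 β (fun τ => f τ (yt τ) (zt τ)) t)
    (hδ : ∀ t ∈ Icc (0 : ℝ) T, |rlInt 0 ε zt t - zt t| ≤ δ) :
    ∀ t ∈ Icc (0 : ℝ) T, |yh t - yt t| ≤ 2 * Real.exp (l * T) * δ := by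
  obtain ⟨t₀, ht₀, hmax⟩ := isCompact_Icc.exists_isMaxOn (nonempty_Icc.2 hT.le)
    (((hw.sub hzt).abs).mul
      (show ContinuousOn (fun t => Real.exp (-(l * t))) (Icc 0 T) by fun_prop))
  obtain ⟨M, hMdef⟩ : ∃ M, M = |w t₀ - zt t₀| * Real.exp (-(l * t₀)) := ⟨_, rfl⟩
  have hM : 0 ≤ M := by rw [hMdef]; positivity
  have hsub : ∀ {t}, t ∈ Icc (0 : ℝ) T → Icc 0 t ⊆ Icc 0 T := fun ht =>
    Icc_subset_Icc_right ht.2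
  have hwM : ∀ t ∈ Icc (0 : ℝ) T, |w t - zt t| ≤ M * Real.exp (l * t) := fun t ht => by
    have h : |w t - zt t| * Real.exp (-(l * t)) ≤ M := hMdef ▸ hmax ht
    rwa [Real.exp_neg, ← div_eq_mul_inv, div_le_iff₀ (Real.exp_pos _)] at h
  have hyM : ∀ t ∈ Icc (0 : ℝ) T, |yh t - yt t| ≤ M * Real.exp (l * t) := fun t ht => by
    rw [heq1 t ht, heq4 t ht, add_sub_add_left_eq_sub,
      ← rlInt_sub (by linarith) ht.1 (hw.mono (hsub ht)) (hzt.mono (hsub ht))]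
    exact abs_rlInt_le_of_abs_le_exp_of_one_le (by linarith) hl ht.1 hM
      fun τ hτ => hwM τ (hsub ht hτ)
  have hzM : ∀ t ∈ Icc (0 : ℝ) T, |z t - zt t| ≤ M / 2 * Real.exp (l * t) := fun t ht => by
    rw [heq3 t ht, heq5 t ht, add_sub_add_left_eq_sub,
      ← rlInt_sub (g := fun τ => f τ (yh τ) (w τ)) (h := fun τ => f τ (yt τ) (zt τ)) hβ ht.1
        ((hfc.comp_continuousOn (continuousOn_id.prodMk (hyh.prodMk hw))).mono (hsub ht))
        ((hfc.comp_continuousOn (continuousOn_id.prodMk (hyt.prodMk hzt))).mono (hsub ht))]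
    have h := abs_rlInt_le_of_abs_le_exp (M := 2 * L * M)
      (g := fun τ => f τ (yh τ) (w τ) - f τ (yt τ) (zt τ)) hβ (by linarith : 0 < l) ht.1
      (by positivity) fun τ hτ => by
        have hτ' := hsub ht hτ
        have h1 := hlip τ hτ' (yh τ) (yt τ) (w τ) (zt τ)
        have h2 := mul_le_mul_of_nonneg_left (add_le_add (hyM τ hτ') (hwM τ hτ')) hL.le
        linarith
    have h3 := mul_le_mul_of_nonneg_right hlL (mul_nonneg hM (Real.exp_pos (l * t)).le)
    refine h.trans ?_
    linarith
  have hw₀ : |w t₀ - zt t₀| ≤ M / 2 * Real.exp (l * t₀) + δ := by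
    have h : w t₀ - zt t₀ =
        rlInt 0 ε (fun τ => z τ - zt τ) t₀ + (rlInt 0 ε zt t₀ - zt t₀) := by
      rw [rlInt_sub hε ht₀.1 (hz.mono (hsub ht₀)) (hzt.mono (hsub ht₀)), ← heq2 t₀ ht₀]
      ring
    rw [h]
    exact (abs_add_le _ _).trans (add_le_add
      (abs_rlInt_le_of_abs_le_exp_of_one_le hε hl ht₀.1 (by linarith)
        fun τ hτ => hzM τ (hsub ht₀ hτ)) (hδ t₀ ht₀))
  have hδ0 : 0 ≤ δ := (abs_nonneg _).trans (hδ t₀ ht₀)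
  have hMδ : M ≤ 2 * δ := by
    have h1 := mul_le_mul_of_nonneg_right hw₀ (Real.exp_pos (-(l * t₀))).le
    have h2 : Real.exp (l * t₀) * Real.exp (-(l * t₀)) = 1 := by
      rw [← Real.exp_add, add_neg_cancel, Real.exp_zero]
    have h3 : δ * Real.exp (-(l * t₀)) ≤ δ := mul_le_of_le_one_right hδ0
      (Real.exp_le_one_iff.2 (neg_nonpos.2 (mul_nonneg (by linarith) ht₀.1)))
    rw [← hMdef, add_mul, mul_assoc, h2] at h1
    linarith
  intro t ht
  have hexp : Real.exp (l * t) ≤ Real.exp (l * T) := by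
    gcongr
    exact ht.2
  calc |yh t - yt t| ≤ M * Real.exp (l * t) := hyM t ht
    _ ≤ 2 * δ * Real.exp (l * T) := by gcongr
    _ = 2 * Real.exp (l * T) * δ := by ring

theorem stmt12 (T α₂ s y₀ L : ℝ) (f : ℝ → ℝ → ℝ → ℝ) (εk : ℕ → ℝ)
    (yh w z yt zt : ℕ → ℝ → ℝ)
    (hT : 0 < T) (hα₂ : 1 < α₂) (hα₂' : α₂ < 2) (hL : 0 < L)
    (hfc : Continuous fun p : ℝ × ℝ × ℝ => f p.1 p.2.1 p.2.2)
    (hlip : ∀ t ∈ Set.Icc (0:ℝ) T, ∀ x₁ x₂ y₁ y₂ : ℝ,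
      |f t x₁ y₁ - f t x₂ y₂| ≤ L * (|x₁ - x₂| + |y₁ - y₂|))
    (hεk : ∀ k, εk k ∈ Set.Ioc (0:ℝ) (1/2))
    (hεlim : Filter.Tendsto εk Filter.atTop (nhds 0))
    (hyh : ∀ k, ContinuousOn (yh k) (Set.Icc 0 T))
    (hw : ∀ k, ContinuousOn (w k) (Set.Icc 0 T))
    (hz : ∀ k, ContinuousOn (z k) (Set.Icc 0 T))
    (hyt : ∀ k, ContinuousOn (yt k) (Set.Icc 0 T))
    (hzt : ∀ k, ContinuousOn (zt k) (Set.Icc 0 T))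
    (heq1 : ∀ k, ∀ t ∈ Set.Icc (0:ℝ) T, yh k t = y₀ + rlInt 0 (1 - εk k) (w k) t)
    (heq2 : ∀ k, ∀ t ∈ Set.Icc (0:ℝ) T, w k t = rlInt 0 (εk k) (z k) t)
    (heq3 : ∀ k, ∀ t ∈ Set.Icc (0:ℝ) T,
      z k t = s + rlInt 0 (α₂ - 1) (fun τ => f τ (yh k τ) (w k τ)) t)
    (heq4 : ∀ k, ∀ t ∈ Set.Icc (0:ℝ) T, yt k t = y₀ + rlInt 0 (1 - εk k) (zt k) t)
    (heq5 : ∀ k, ∀ t ∈ Set.Icc (0:ℝ) T,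
      zt k t = s + rlInt 0 (α₂ - 1) (fun τ => f τ (yt k τ) (zt k τ)) t)
    (hnorm : Filter.Tendsto
      (fun k => ⨆ τ : Set.Icc (0:ℝ) T, |rlInt 0 (εk k) (zt k) τ - zt k τ|)
      Filter.atTop (nhds 0)) :
    Filter.Tendsto (fun k => ⨆ t : Set.Icc (0:ℝ) T, |yh k t - yt k t|)
      Filter.atTop (nhds 0) := by
  obtain ⟨l, hl, hlL⟩ := exists_one_le_mul_rpow_neg_le (c := 2 * L) (sub_pos.2 hα₂)
  have hlim := hnorm.const_mul (2 * Real.exp (l * T))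
  rw [mul_zero] at hlim
  have : Nonempty (Set.Icc (0 : ℝ) T) := ⟨⟨0, le_rfl, hT.le⟩⟩
  refine squeeze_zero (fun k => Real.iSup_nonneg fun t => abs_nonneg _) (fun k => ?_) hlim
  refine ciSup_le fun t => ?_
  exact abs_sub_le_of_volterra_system hT (sub_pos.2 hα₂) hL hfc hlip (hεk k).1
    (by linarith [(hεk k).2]) hl hlL (hyh k) (hw k) (hz k) (hyt k) (hzt k) (heq1 k) (heq2 k)
    (heq3 k) (heq4 k) (heq5 k)
    (fun τ hτ => le_ciSup (bddAbove_abs_rlInt_sub (hεk k).1 (hzt k)) ⟨τ, hτ⟩) t t.2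
end
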